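/- arXiv:2106.15443 — 2 statements merged into one kernel-verified Lean document; each statement's English description precedes it below -/
import Mathlib

section
/- Let m, s, M ∈ ℝ satisfy m < s < M and M = s − 2m, and set a = −M·m − (M+m)·m. Let φ : ℝ → ℝ be continuous and even with φ(0) = s, φ infinitely differentiable on (0, ∞) with φ'(x) < 0 there, φ(x) → m as x → ∞, and (s − φ(x))·φ'(x)² = (M − φ(x))·(φ(x) − m)² for all x ∈ (0, ∞). Set u(t,x) = φ(x − s·t), u_x(t,x) = φ'(x − s·t) (defined almost everywhere), and P(t,x) = (a + s² − (s − φ(x − s·t))²)/2. Then the energy conservation law holds weakly: for every test function Φ ∈ C_c^∞(ℝ × ℝ), ∬_{ℝ²} [ (u² + u_x²)·∂_tΦ + ( u·(u² + u_x²) − u³ + 2·P·u )·∂_xΦ ] dx dt = 0. -/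
open MeasureTheory Set Filter

/-- A function of the second variable of a product of lines is locally integrable on the plane
if it is locally integrable on the line. -/
lemma locallyIntegrable_comp_snd {E : ℝ → ℝ} (hE : LocallyIntegrable E) :
    LocallyIntegrable (fun p : ℝ × ℝ => E p.2) := by
  rw [locallyIntegrable_iff]
  intro K hK
  have hsub : K ⊆ (Prod.fst '' K) ×ˢ (Prod.snd '' K) := fun p hp =>
    ⟨mem_image_of_mem _ hp, mem_image_of_mem _ hp⟩
  refine IntegrableOn.mono_set ?_ hsub
  have h1 : IntegrableOn (fun _ : ℝ => (1 : ℝ)) (Prod.fst '' K) :=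
    continuous_const.continuousOn.integrableOn_compact (hK.image continuous_fst)
  have h2 : IntegrableOn E (Prod.snd '' K) :=
    hE.integrableOn_isCompact (hK.image continuous_snd)
  rw [IntegrableOn, Measure.volume_eq_prod, ← Measure.prod_restrict]
  simpa using Integrable.mul_prod h1 h2

lemma HasCompactSupport.comp_prodMk {g : ℝ × ℝ → ℝ} (hg : HasCompactSupport g) (t : ℝ) :
    HasCompactSupport (fun y => g (t, y)) :=
  hg.comp_isClosedEmbedding (Isometry.isClosedEmbedding fun _ _ => by simp [Prod.edist_eq])

lemma HasCompactSupport.comp_prodMk_left {g : ℝ × ℝ → ℝ} (hg : HasCompactSupport g) (y : ℝ) :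
    HasCompactSupport (fun t => g (t, y)) :=
  hg.comp_isClosedEmbedding (Isometry.isClosedEmbedding fun _ _ => by simp [Prod.edist_eq])

lemma HasCompactSupport.fderiv_apply_const {F : ℝ × ℝ → ℝ} (hF : HasCompactSupport F)
    (v : ℝ × ℝ) : HasCompactSupport (fun p => fderiv ℝ F p v) :=
  hF.fderiv (𝕜 := ℝ) |>.comp_left (g := fun L : ℝ × ℝ →L[ℝ] ℝ => L v) rfl

lemma ContDiff.continuous_fderiv_apply_const {F : ℝ × ℝ → ℝ} (hF : ContDiff ℝ 1 F)
    (v : ℝ × ℝ) : Continuous (fun p => fderiv ℝ F p v) :=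
  (hF.continuous_fderiv one_ne_zero).clm_apply continuous_const

lemma ContDiff.hasDerivAt_fst {F : ℝ × ℝ → ℝ} (hF : ContDiff ℝ 1 F) (t x : ℝ) :
    HasDerivAt (fun τ => F (τ, x)) (fderiv ℝ F (t, x) (1, 0)) t :=
  ((hF.differentiable one_ne_zero) (t, x)).hasFDerivAt.comp_hasDerivAt t
    ((hasDerivAt_id t).prodMk (hasDerivAt_const t x))

lemma ContDiff.hasDerivAt_snd {F : ℝ × ℝ → ℝ} (hF : ContDiff ℝ 1 F) (t x : ℝ) :
    HasDerivAt (fun y => F (t, y)) (fderiv ℝ F (t, x) (0, 1)) x :=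
  ((hF.differentiable one_ne_zero) (t, x)).hasFDerivAt.comp_hasDerivAt x
    ((hasDerivAt_const x t).prodMk (hasDerivAt_id x))

/-- A locally integrable density that does not depend on `t` is weakly constant in `t`. -/
lemma integral_integral_mul_fderiv_fst_eq_zero {E : ℝ → ℝ} (hE : LocallyIntegrable E)
    {H : ℝ × ℝ → ℝ} (hH : ContDiff ℝ 1 H) (hc : HasCompactSupport H) :
    ∫ t : ℝ, ∫ y : ℝ, E y * fderiv ℝ H (t, y) (1, 0) = 0 := by
  have hint : Integrable (fun p : ℝ × ℝ => E p.2 * fderiv ℝ H p (1, 0)) :=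
    (locallyIntegrable_comp_snd hE).integrable_smul_right_of_hasCompactSupport
      (hH.continuous_fderiv_apply_const (1, 0)) (hc.fderiv_apply_const (1, 0))
  rw [integral_integral_swap (f := fun t y => E y * fderiv ℝ H (t, y) (1, 0)) hint]
  have hzero : ∀ y : ℝ, ∫ t : ℝ, E y * fderiv ℝ H (t, y) (1, 0) = 0 := fun y => by
    rw [integral_const_mul, integral_eq_zero_of_hasDerivAt_of_integrable
      (fun t => hH.hasDerivAt_fst t y), mul_zero]
    · exact Continuous.integrable_of_hasCompactSupport
        ((hH.continuous_fderiv_apply_const (1, 0)).comp (by fun_prop))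
        ((hc.fderiv_apply_const (1, 0)).comp_prodMk_left y)
    · exact Continuous.integrable_of_hasCompactSupport (hH.continuous.comp (by fun_prop))
        (hc.comp_prodMk_left y)
  simp [hzero]

/-- If the flux of a travelling wave is `s` times its density plus a constant, the wave satisfies
the conservation law weakly. -/
lemma integral_travelingWave_eq_zero {A B : ℝ → ℝ} {s C : ℝ} (hA : LocallyIntegrable A)
    (hB : ∀ y ≠ 0, B y = s * A y + C) {F : ℝ × ℝ → ℝ} (hF : ContDiff ℝ 1 F)
    (hc : HasCompactSupport F) :
    ∫ t : ℝ, ∫ x : ℝ, (A (x - s * t) * fderiv ℝ F (t, x) (1, 0)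
      + B (x - s * t) * fderiv ℝ F (t, x) (0, 1)) = 0 := by
  let e : ℝ × ℝ ≃ₜ ℝ × ℝ :=
    { toFun := fun p => (p.1, p.2 + s * p.1)
      invFun := fun p => (p.1, p.2 - s * p.1)
      left_inv := fun p => by simp
      right_inv := fun p => by simp
      continuous_toFun := by fun_prop
      continuous_invFun := by fun_prop }
  have hH : ContDiff ℝ 1 (F ∘ e) :=
    hF.comp (contDiff_fst.prodMk (contDiff_snd.add (contDiff_const.mul contDiff_fst)))
  have hHc : HasCompactSupport (F ∘ e) := hc.comp_homeomorph e
  have hderiv : ∀ t y, fderiv ℝ (F ∘ e) (t, y) (1, 0)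
      = fderiv ℝ F (t, y + s * t) (1, 0) + s * fderiv ℝ F (t, y + s * t) (0, 1) := fun t y => by
    have h1 := hH.hasDerivAt_fst t y
    have hγ : HasDerivAt (fun τ : ℝ => (τ, y + s * τ)) ((1 : ℝ), s) t :=
      (hasDerivAt_id t).prodMk (by simpa using ((hasDerivAt_id t).const_mul s).const_add y)
    have h2 : HasDerivAt (fun τ => (F ∘ e) (τ, y)) (fderiv ℝ F (t, y + s * t) (1, s)) t :=
      ((hF.differentiable one_ne_zero) (t, y + s * t)).hasFDerivAt.comp_hasDerivAt t hγ
    rw [h1.unique h2, show ((1 : ℝ), s) = (1, 0) + s • ((0 : ℝ), (1 : ℝ)) by simp, map_add,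
      map_smul, smul_eq_mul]
  refine (integral_congr_ae (Eventually.of_forall fun t => ?_)).trans
    (integral_integral_mul_fderiv_fst_eq_zero hA hH hHc)
  have hdx : Integrable (fun x => fderiv ℝ F (t, x) (0, 1)) :=
    Continuous.integrable_of_hasCompactSupport
      ((hF.continuous_fderiv_apply_const (0, 1)).comp (by fun_prop))
      ((hc.fderiv_apply_const (0, 1)).comp_prodMk t)
  have hdx0 : ∫ x : ℝ, fderiv ℝ F (t, x) (0, 1) = 0 :=
    integral_eq_zero_of_hasDerivAt_of_integrable (fun x => hF.hasDerivAt_snd t x) hdx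
      (Continuous.integrable_of_hasCompactSupport (hF.continuous.comp (by fun_prop))
        (hc.comp_prodMk t))
  have hAint : Integrable (fun y => A y * fderiv ℝ (F ∘ e) (t, y) (1, 0)) :=
    hA.integrable_smul_right_of_hasCompactSupport
      ((hH.continuous_fderiv_apply_const (1, 0)).comp (by fun_prop))
      ((hHc.fderiv_apply_const (1, 0)).comp_prodMk t)
  calc ∫ x : ℝ, (A (x - s * t) * fderiv ℝ F (t, x) (1, 0)
        + B (x - s * t) * fderiv ℝ F (t, x) (0, 1))
      = ∫ y : ℝ, (A y * fderiv ℝ F (t, y + s * t) (1, 0)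
        + B y * fderiv ℝ F (t, y + s * t) (0, 1)) := by
        rw [← integral_add_right_eq_self _ (s * t)]
        simp
    _ = ∫ y : ℝ, (A y * fderiv ℝ (F ∘ e) (t, y) (1, 0)
        + C * fderiv ℝ F (t, y + s * t) (0, 1)) := by
        refine integral_congr_ae ?_
        filter_upwards [Measure.ae_ne volume (0 : ℝ)] with y hy
        rw [hderiv, hB y hy]
        ring
    _ = ∫ y : ℝ, A y * fderiv ℝ (F ∘ e) (t, y) (1, 0) := by
        rw [integral_add hAint ((hdx.comp_add_right (s * t)).const_mul C), integral_const_mul,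
          integral_add_right_eq_self (fun x => fderiv ℝ F (t, x) (0, 1)), hdx0, mul_zero, add_zero]

/-- An even function that is integrable on every `(0, R]` is locally integrable. -/
lemma locallyIntegrable_of_even {f : ℝ → ℝ} (heven : ∀ x, f (-x) = f x)
    (hf : ∀ R, 0 < R → IntegrableOn f (Ioc 0 R)) : LocallyIntegrable f := by
  rw [locallyIntegrable_iff]
  intro K hK
  obtain ⟨R, hR, hKR⟩ := hK.isBounded.subset_closedBall_lt 0 0
  refine IntegrableOn.mono_set ?_ hKR
  rw [Real.closedBall_eq_Icc, zero_sub, zero_add, ← intervalIntegrable_iff_integrableOn_Icc_of_le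
    (by linarith)]
  exact intervalIntegrable_of_even (fun x => (heven x).symm) fun x hx =>
    (intervalIntegrable_iff_integrableOn_Ioc_of_le hx.le).2 (hf x hx)

/-- The squared slope of a cuspon profile is integrable up to the cusp: it is dominated by a
multiple of the derivative of `2 * √(s - φ)`. -/
lemma integrableOn_sq_deriv_of_cusp {M m s R : ℝ} {φ φ' : ℝ → ℝ}
    (hcont : Continuous φ) (hderiv : ∀ x ∈ Ioi (0 : ℝ), HasDerivAt φ (φ' x) x)
    (hneg : ∀ x ∈ Ioi (0 : ℝ), φ' x < 0)
    (hm : ∀ x ∈ Ioi (0 : ℝ), m < φ x) (hs : ∀ x ∈ Ioi (0 : ℝ), φ x < s) (hsM : s < M)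
    (hode : ∀ x ∈ Ioi (0 : ℝ), (s - φ x) * (φ' x) ^ 2 = (M - φ x) * (φ x - m) ^ 2) :
    IntegrableOn (fun x => (φ' x) ^ 2) (Ioc 0 R) := by
  have hG : IntegrableOn (fun x => -φ' x / √(s - φ x)) (Ioc 0 R) := by
    refine intervalIntegral.integrableOn_deriv_of_nonneg (g := fun x => 2 * √(s - φ x))
      (by fun_prop) (fun x hx => ?_) (fun x hx => ?_)
    · have hpos : s - φ x ≠ 0 := (sub_pos.2 (hs x hx.1)).ne'
      refine ((((hderiv x hx.1).const_sub s).sqrt hpos).const_mul 2).congr_deriv ?_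
      ring
    · exact div_nonneg (neg_nonneg.2 (hneg x hx.1).le) (Real.sqrt_nonneg _)
  have hmeas : AEStronglyMeasurable (fun x => (φ' x) ^ 2) (volume.restrict (Ioc 0 R)) := by
    refine (((measurable_deriv φ).pow_const 2).aestronglyMeasurable).congr ?_
    filter_upwards [ae_restrict_mem measurableSet_Ioc] with x hx
    rw [(hderiv x hx.1).deriv]
  refine Integrable.mono' (hG.const_mul (√(M - m) * (s - m))) hmeas ?_
  filter_upwards [ae_restrict_mem measurableSet_Ioc] with x hx
  have hx0 : x ∈ Ioi (0 : ℝ) := hx.1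
  have h1 := hm x hx0
  have h2 := hs x hx0
  have h3 := hneg x hx0
  have hsq : 0 < √(s - φ x) := Real.sqrt_pos.2 (sub_pos.2 h2)
  have hslope : -φ' x * √(s - φ x) = √(M - φ x) * (φ x - m) := by
    have h4 : 0 ≤ -φ' x * √(s - φ x) := mul_nonneg (by linarith) hsq.le
    have h5 : 0 ≤ √(M - φ x) * (φ x - m) := mul_nonneg (Real.sqrt_nonneg _) (by linarith)
    rw [← sq_eq_sq₀ h4 h5, mul_pow, mul_pow, Real.sq_sqrt (by linarith), Real.sq_sqrt (by linarith),
      ← hode x hx0]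
    ring
  have hbound : -φ' x * √(s - φ x) ≤ √(M - m) * (s - m) := by
    rw [hslope]
    gcongr
  rw [Real.norm_of_nonneg (sq_nonneg _)]
  calc (φ' x) ^ 2 = (-φ' x * √(s - φ x)) * (-φ' x / √(s - φ x)) := by field_simp
    _ ≤ √(M - m) * (s - m) * (-φ' x / √(s - φ x)) := by
      gcongr
      exact div_nonneg (by linarith) hsq.le

/-- The cuspon with decay of the Camassa–Holm equation (parameters `m < s < M` with
`M = s − 2m`, a single cusp of height `s` at the origin, strictly decreasing on
`(0, ∞)` and tending to `m` at infinity) satisfies the energy conservation law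
`(u² + u_x²)_t + (u(u² + u_x²))_x = (u³ − 2Pu)_x` in the weak sense: for every test
function `Φ` the corresponding double integral vanishes. Here `a = −Mm − (M+m)m` and
`P(t,x) = (a + s² − (s − φ(x − st))²)/2`. -/
theorem decaying_cuspon_conservative (M m s a : ℝ)
    (hms : m < s) (hsM : s < M) (hM : M = s - 2 * m)
    (ha : a = -(M * m) - (M + m) * m)
    (φ φ' : ℝ → ℝ)
    (hcont : Continuous φ) (heven : ∀ x, φ (-x) = φ x)
    (hcusp : φ 0 = s)
    (hsmooth : ContDiffOn ℝ (⊤ : ℕ∞) φ (Ioi 0))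
    (hderiv : ∀ x ∈ Ioi (0 : ℝ), HasDerivAt φ (φ' x) x)
    (hneg : ∀ x ∈ Ioi (0 : ℝ), φ' x < 0)
    (hdecay : Tendsto φ atTop (nhds m))
    (hode : ∀ x ∈ Ioi (0 : ℝ),
      (s - φ x) * (φ' x) ^ 2 = (M - φ x) * (φ x - m) ^ 2)
    (hφ'odd : ∀ x, φ' (-x) = -φ' x) :
    ∀ Φ : ℝ → ℝ → ℝ,
      ContDiff ℝ (⊤ : ℕ∞) (fun p : ℝ × ℝ => Φ p.1 p.2) →
      HasCompactSupport (fun p : ℝ × ℝ => Φ p.1 p.2) →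
      (∫ t : ℝ, ∫ x : ℝ,
        ((φ (x - s * t)) ^ 2 + (φ' (x - s * t)) ^ 2) * deriv (fun τ => Φ τ x) t
          + (φ (x - s * t) * ((φ (x - s * t)) ^ 2 + (φ' (x - s * t)) ^ 2)
              - (φ (x - s * t)) ^ 3
              + 2 * ((a + s ^ 2 - (s - φ (x - s * t)) ^ 2) / 2) * φ (x - s * t))
            * deriv (Φ t) x) = 0 := by
  intro Φ hΦ hc
  have hanti : StrictAntiOn φ (Ici 0) :=
    strictAntiOn_of_deriv_neg (convex_Ici 0) hcont.continuousOn fun x hx => by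
      rw [interior_Ici] at hx
      rw [(hderiv x hx).deriv]
      exact hneg x hx
  have hs : ∀ x ∈ Ioi (0 : ℝ), φ x < s := fun x hx => by
    rw [← hcusp]
    exact hanti self_mem_Ici (mem_Ioi.1 hx).le hx
  have hm : ∀ x ∈ Ioi (0 : ℝ), m < φ x := fun x hx => by
    have hx' : (0 : ℝ) < x := hx
    have h1 : φ (x + 1) < φ x := hanti hx'.le (by simp; linarith) (by linarith)
    refine lt_of_le_of_lt (le_of_tendsto hdecay ?_) h1
    filter_upwards [eventually_ge_atTop (x + 1)] with y hy
    exact hanti.antitoneOn (by simp; linarith) (by simp; linarith) hy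
  have hA : LocallyIntegrable (fun y => φ y ^ 2 + φ' y ^ 2) :=
    (hcont.pow 2).locallyIntegrable.add <| locallyIntegrable_of_even
      (fun x => by rw [hφ'odd, neg_sq]) fun R _ =>
        integrableOn_sq_deriv_of_cusp hcont hderiv hneg hm hs hsM hode
  have hode' : ∀ y ≠ 0, (s - φ y) * φ' y ^ 2 = (M - φ y) * (φ y - m) ^ 2 := fun y hy => by
    rcases lt_or_gt_of_ne hy with h | h
    · simpa [heven, hφ'odd] using hode (-y) (neg_pos.2 h)
    · exact hode y h
  have hflux : ∀ y ≠ 0, φ y * (φ y ^ 2 + φ' y ^ 2) - φ y ^ 3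
      + 2 * ((a + s ^ 2 - (s - φ y) ^ 2) / 2) * φ y
      = s * (φ y ^ 2 + φ' y ^ 2) + -(M * m ^ 2) := fun y hy => by
    subst ha hM
    linear_combination -hode' y hy
  have hF : ContDiff ℝ 1 (fun p : ℝ × ℝ => Φ p.1 p.2) := hΦ.of_le (by exact_mod_cast le_top)
  rw [← integral_travelingWave_eq_zero hA hflux hF hc]
  congr! 5 with t x
  · rw [← (hF.hasDerivAt_fst t _).deriv]
  · rw [← (hF.hasDerivAt_snd t _).deriv]
end

section
/- Let s > 0, L > 0, and |w₀| < L, and let w(t) = −2·artanh( tanh(L/2) · tanh( (s·t/2)·tanh(L) − artanh( tanh(w₀/2)/tanh(L/2) ) ) ). Then w(t) → −L as t → +∞ and w(t) → +L as t → −∞. -/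
open Filter

/-- The inverse hyperbolic tangent. -/
noncomputable def artanh (x : ℝ) : ℝ := Real.log ((1 + x) / (1 - x)) / 2

theorem artanh_tanh (x : ℝ) : artanh (Real.tanh x) = x := by
  have h := Real.artanh_eq_half_log
    (x := Real.tanh x) ⟨(Real.neg_one_lt_tanh x).le, (Real.tanh_lt_one x).le⟩
  rw [Real.artanh_tanh] at h
  rw [artanh]
  linarith

theorem artanh_neg (x : ℝ) : artanh (-x) = -artanh x := by
  have h : (1 + -x) / (1 - -x) = ((1 + x) / (1 - x))⁻¹ := by
    rw [inv_div, sub_neg_eq_add, ← sub_eq_add_neg]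
  rw [artanh, artanh, h, Real.log_inv, neg_div]

theorem continuousAt_artanh {x : ℝ} (h₁ : -1 < x) (h₂ : x < 1) : ContinuousAt artanh x := by
  have h : (1 + x) / (1 - x) ≠ 0 := (div_pos (by linarith) (by linarith)).ne'
  have h' : 1 - x ≠ 0 := by linarith
  unfold artanh
  fun_prop (disch := assumption)

theorem tanh_eq_one_sub_two_div (x : ℝ) : Real.tanh x = 1 - 2 / (Real.exp (2 * x) + 1) := by
  have h := Real.exp_pos x
  rw [Real.tanh_eq, two_mul, Real.exp_add, Real.exp_neg]
  field_simp
  ring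

theorem tendsto_tanh_atTop : Tendsto Real.tanh atTop (nhds 1) := by
  have h : Tendsto (fun x : ℝ => Real.exp (2 * x) + 1) atTop atTop :=
    tendsto_atTop_add_const_right _ _
      (Real.tendsto_exp_atTop.comp (tendsto_id.const_mul_atTop two_pos))
  simpa [← tanh_eq_one_sub_two_div] using (h.const_div_atTop 2).const_sub 1

theorem tendsto_tanh_atBot : Tendsto Real.tanh atBot (nhds (-1)) := by
  simpa [Function.comp_def] using (tendsto_tanh_atTop.comp tendsto_neg_atBot_atTop).neg

/-- Asymptotics of the shifted characteristic of the periodic peakon of the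
Camassa–Holm equation with speed `s > 0`: characteristics starting strictly between
two consecutive peaks tend to `−L` as `t → +∞` and to `+L` as `t → −∞`. -/
theorem periodic_peakon_characteristic_asymptotics (s L w₀ : ℝ) (hs : 0 < s)
    (hL : 0 < L) (hw₀ : |w₀| < L) (w : ℝ → ℝ)
    (hw : ∀ t, w t = -2 * artanh (Real.tanh (L / 2) *
      Real.tanh (s * t / 2 * Real.tanh L - artanh (Real.tanh (w₀ / 2) / Real.tanh (L / 2))))) :
    Tendsto w atTop (nhds (-L)) ∧ Tendsto w atBot (nhds L) := by
  have hlim : ∀ c : ℝ, -1 < Real.tanh (L / 2) * c → Real.tanh (L / 2) * c < 1 →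
      ∀ (l : Filter ℝ) (g : ℝ → ℝ), Tendsto (fun t => Real.tanh (g t)) l (nhds c) →
      Tendsto (fun t => -2 * artanh (Real.tanh (L / 2) * Real.tanh (g t))) l
        (nhds (-2 * artanh (Real.tanh (L / 2) * c))) := fun c h₁ h₂ l g hg =>
    ((continuousAt_artanh h₁ h₂).tendsto.comp (hg.const_mul _)).const_mul _
  have h₁ := Real.neg_one_lt_tanh (L / 2)
  have h₂ := Real.tanh_lt_one (L / 2)
  have hT : 0 < s / 2 * Real.tanh L := by
    rw [Real.tanh_eq_sinh_div_cosh]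
    have := Real.sinh_pos_iff.2 hL
    have := Real.cosh_pos L
    positivity
  have hphase : ∀ t, s * t / 2 * Real.tanh L = s / 2 * Real.tanh L * t := fun t => by ring
  have htop : -2 * artanh (Real.tanh (L / 2) * 1) = -L := by
    rw [mul_one, artanh_tanh]
    ring
  have hbot : -2 * artanh (Real.tanh (L / 2) * -1) = L := by
    rw [mul_neg_one, artanh_neg, artanh_tanh]
    ring
  rw [funext hw]
  simp only [hphase, sub_eq_add_neg]
  constructor
  · have h := hlim 1 (by linarith) (by linarith) atTop _ (tendsto_tanh_atTop.comp
      (tendsto_atTop_add_const_right _ (-artanh (Real.tanh (w₀ / 2) / Real.tanh (L / 2)))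
        (tendsto_id.const_mul_atTop hT)))
    rwa [htop] at h
  · have h := hlim (-1) (by linarith) (by linarith) atBot _ (tendsto_tanh_atBot.comp
      (tendsto_atBot_add_const_right _ (-artanh (Real.tanh (w₀ / 2) / Real.tanh (L / 2)))
        (tendsto_id.const_mul_atBot hT)))
    rwa [hbot] at h
end
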